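/- In the setting of a Cordes coefficient family: for all smooth ℤⁿ-periodic functions u₁, u₂ : ℝⁿ → ℝ, writing δu := u₁ − u₂, one has ∫_Y (F_γ[u₁] − F_γ[u₂]) · L_λ(δu) ≥ (1 − √(1−δ)) ∫_Y (L_λ(δu))². -/

import Mathlib

open MeasureTheory Matrix BigOperators

/-- Frobenius inner product `A : M = tr(Aᵀ M)` of two real `n × n` matrices. -/
noncomputable def fip {n : ℕ} (A M : Matrix (Fin n) (Fin n) ℝ) : ℝ := (Aᵀ * M).trace

/-- Renormalization function `γ = (tr A + c/λ) / (|A|² + |b|²/(2λ) + c²/λ²)`. -/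
noncomputable def gam {n : ℕ} (lam : ℝ) (A : Matrix (Fin n) (Fin n) ℝ)
    (b : Fin n → ℝ) (c : ℝ) : ℝ :=
  (A.trace + c / lam) / (fip A A + (∑ i, b i ^ 2) / (2 * lam) + c ^ 2 / lam ^ 2)

/-- Partial derivative `∂v/∂xᵢ` of a function on `ℝⁿ = Fin n → ℝ`. -/
noncomputable def pd {n : ℕ} (i : Fin n) (v : (Fin n → ℝ) → ℝ) (x : Fin n → ℝ) : ℝ :=
  fderiv ℝ v x (Pi.single i 1)

/-- Hessian matrix of a function on `ℝⁿ`. -/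
noncomputable def hess {n : ℕ} (v : (Fin n → ℝ) → ℝ) (x : Fin n → ℝ) :
    Matrix (Fin n) (Fin n) ℝ :=
  Matrix.of fun i j => pd i (pd j v) x

/-- The operator `L_λ v = λ v − Δ v`. -/
noncomputable def Llam {n : ℕ} (lam : ℝ) (v : (Fin n → ℝ) → ℝ) (x : Fin n → ℝ) : ℝ :=
  lam * v x - ∑ i, pd i (pd i v) x

/-- `ℤⁿ`-periodicity of a function on `ℝⁿ`. -/
def ZPeriodic {n : ℕ} (v : (Fin n → ℝ) → ℝ) : Prop :=
  ∀ (x : Fin n → ℝ) (z : Fin n → ℤ), v (x + fun i => (z i : ℝ)) = v x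

/-- The renormalized HJBI operator
`F_γ[v](y) = inf_α sup_β γ·(−A:∇²v − b·∇v + c v − f)` evaluated at `(y,α,β)`. -/
noncomputable def Fgam {n : ℕ} {𝒜 ℬ : Type} (lam : ℝ)
    (A : (Fin n → ℝ) × 𝒜 × ℬ → Matrix (Fin n) (Fin n) ℝ)
    (b : (Fin n → ℝ) × 𝒜 × ℬ → Fin n → ℝ)
    (c f : (Fin n → ℝ) × 𝒜 × ℬ → ℝ)
    (v : (Fin n → ℝ) → ℝ) (y : Fin n → ℝ) : ℝ :=
  ⨅ α : 𝒜, ⨆ β : ℬ,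
    gam lam (A (y, α, β)) (b (y, α, β)) (c (y, α, β)) *
      (-(fip (A (y, α, β)) (hess v y)) - (∑ i, b (y, α, β) i * pd i v y)
        + c (y, α, β) * v y - f (y, α, β))

abbrev Smth {n : ℕ} (v : (Fin n → ℝ) → ℝ) : Prop := ContDiff ℝ (⊤ : ℕ∞) v

lemma smth_pd {n : ℕ} (i : Fin n) {v : (Fin n → ℝ) → ℝ} (hv : Smth v) : Smth (pd i v) := by
  have h : ContDiff ℝ (⊤ : ℕ∞) (fderiv ℝ v) := hv.fderiv_right (by exact_mod_cast le_top)
  exact h.clm_apply contDiff_const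

lemma smth_diff {n : ℕ} {v : (Fin n → ℝ) → ℝ} (hv : Smth v) : Differentiable ℝ v :=
  hv.differentiable (by simp)

lemma per_pd {n : ℕ} (i : Fin n) {v : (Fin n → ℝ) → ℝ} (hv : ZPeriodic v) :
    ZPeriodic (pd i v) := by
  intro x z
  unfold pd
  rw [← fderiv_comp_add_right]
  congr 2
  funext y
  exact hv y z

lemma pd_comm {n : ℕ} (i j : Fin n) {v : (Fin n → ℝ) → ℝ} (hv : Smth v) :
    pd i (pd j v) = pd j (pd i v) := by
  have key : ∀ (i j : Fin n) (x : Fin n → ℝ),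
      pd i (pd j v) x = fderiv ℝ (fderiv ℝ v) x (Pi.single i 1) (Pi.single j 1) := by
    intro i j x
    have h : ContDiff ℝ (⊤ : ℕ∞) (fderiv ℝ v) := hv.fderiv_right (by exact_mod_cast le_top)
    have hd : DifferentiableAt ℝ (fderiv ℝ v) x := h.differentiable (by simp) x
    unfold pd
    rw [fderiv_clm_apply hd (differentiableAt_const _)]
    simp
  funext x
  rw [key, key]
  have hs : IsSymmSndFDerivAt ℝ v x :=
    (hv.contDiffAt).isSymmSndFDerivAt (by
      rw [minSmoothness_of_isRCLikeNormedField]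
      exact WithTop.coe_le_coe.mpr (le_top : (2 : ℕ∞) ≤ ⊤))
  exact hs _ _

lemma pd_mul {n : ℕ} (i : Fin n) {v w : (Fin n → ℝ) → ℝ} (hv : Smth v) (hw : Smth w)
    (x : Fin n → ℝ) :
    pd i (fun y => v y * w y) x = v x * pd i w x + pd i v x * w x := by
  unfold pd
  rw [fderiv_fun_mul (smth_diff hv x) (smth_diff hw x)]
  simp [mul_comm]

lemma pd_sub {n : ℕ} (i : Fin n) {v w : (Fin n → ℝ) → ℝ} (hv : Smth v) (hw : Smth w) :
    pd i (v - w) = pd i v - pd i w := by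
  funext x
  unfold pd
  rw [fderiv_sub (smth_diff hv x) (smth_diff hw x)]
  simp

lemma int_on {n : ℕ} {g : (Fin n → ℝ) → ℝ} (hg : Continuous g) :
    IntegrableOn g (Set.Icc (0 : Fin n → ℝ) 1) :=
  hg.continuousOn.integrableOn_compact isCompact_Icc

lemma int_pd {n : ℕ} (i : Fin n) {v : (Fin n → ℝ) → ℝ} (hv : Smth v) (hp : ZPeriodic v) :
    ∫ x in Set.Icc (0 : Fin n → ℝ) 1, pd i v x = 0 := by
  obtain _ | m := n
  · exact i.elim0
  have hsum : ∀ x, (∑ j : Fin (m + 1), (if j = i then fderiv ℝ v x else 0) (Pi.single j 1))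
      = pd i v x := by
    intro x
    rw [Finset.sum_eq_single i]
    · simp [pd]
    · intro j _ hj
      simp [hj]
    · simp
  have h := integral_divergence_of_hasFDerivAt_off_countable' (0 : Fin (m + 1) → ℝ) 1
    (fun _ => zero_le_one) (fun j x => if j = i then v x else 0)
    (fun j x => if j = i then fderiv ℝ v x else 0) ∅ Set.countable_empty
    (by
      intro j
      by_cases hj : j = i
      · simpa [hj] using hv.continuous.continuousOn
      · simpa [hj] using continuousOn_const)
    (by
      intro x _ j
      by_cases hj : j = i
      · simpa [hj] using (smth_diff hv x).hasFDerivAt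
      · simpa [hj] using hasFDerivAt_const (0 : ℝ) x)
    (by
      simp only [hsum]
      exact int_on (smth_pd i hv).continuous)
  simp only [hsum] at h
  rw [h]
  apply Finset.sum_eq_zero
  intro j _
  by_cases hj : j = i
  · subst hj
    simp only [if_true]
    rw [sub_eq_zero]
    congr 1
    funext x
    have := hp (j.insertNth ((0 : Fin (m + 1) → ℝ) j) x) (Pi.single j 1)
    rw [← this]
    congr 1
    funext k
    refine Fin.succAboveCases j ?_ (fun l => ?_) k
    · simp
    · simp [Fin.succAbove_ne]
  · simp [hj]

/-- The energy density. -/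
noncomputable def Gd {n : ℕ} (lam : ℝ) (w : (Fin n → ℝ) → ℝ) (x : Fin n → ℝ) : ℝ :=
  (∑ i, ∑ j, (pd i (pd j w) x) ^ 2) + 2 * lam * (∑ i, (pd i w x) ^ 2) + lam ^ 2 * (w x) ^ 2

lemma cont_Llam {n : ℕ} (lam : ℝ) {w : (Fin n → ℝ) → ℝ} (hw : Smth w) :
    Continuous (Llam lam w) := by
  unfold Llam
  have h0 := hw.continuous
  have h2 : ∀ i j, Continuous (pd i (pd j w)) := fun i j => (smth_pd i (smth_pd j hw)).continuous
  exact (continuous_const.mul h0).sub (continuous_finsetSum _ fun i _ => h2 i i)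

lemma int_sq {n : ℕ} (lam : ℝ) {w : (Fin n → ℝ) → ℝ} (hw : Smth w) :
    IntegrableOn (fun x => (Llam lam w x) ^ 2) (Set.Icc (0 : Fin n → ℝ) 1) :=
  int_on ((cont_Llam lam hw).pow 2)

lemma cont_Gd {n : ℕ} (lam : ℝ) {w : (Fin n → ℝ) → ℝ} (hw : Smth w) :
    Continuous (Gd lam w) := by
  unfold Gd
  have h0 := hw.continuous
  have h1 : ∀ i, Continuous (pd i w) := fun i => (smth_pd i hw).continuous
  have h2 : ∀ i j, Continuous (pd i (pd j w)) := fun i j => (smth_pd i (smth_pd j hw)).continuous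
  fun_prop

lemma energy {n : ℕ} (lam : ℝ) {w : (Fin n → ℝ) → ℝ} (hw : Smth w) (hp : ZPeriodic w) :
    ∫ x in Set.Icc (0 : Fin n → ℝ) 1, Gd lam w x
      = ∫ x in Set.Icc (0 : Fin n → ℝ) 1, (Llam lam w x) ^ 2 := by
  have hs1 : ∀ i, Smth (pd i w) := fun i => smth_pd i hw
  have hs2 : ∀ i j, Smth (pd i (pd j w)) := fun i j => smth_pd i (hs1 j)
  have hp1 : ∀ i, ZPeriodic (pd i w) := fun i => per_pd i hp
  have hp2 : ∀ i j, ZPeriodic (pd i (pd j w)) := fun i j => per_pd i (hp1 j)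
  have hmul : ∀ {a b : (Fin n → ℝ) → ℝ}, ZPeriodic a → ZPeriodic b →
      ZPeriodic (fun y => a y * b y) := by
    intro a b ha hb x z
    simp only [ha x z, hb x z]
  have a1 : ∀ i, Smth (fun y => w y * pd i w y) := fun i => hw.mul (hs1 i)
  have a2 : ∀ i j, Smth (fun y => pd i (pd i w) y * pd j w y) :=
    fun i j => (hs2 i i).mul (hs1 j)
  have a3 : ∀ i j, Smth (fun y => pd j w y * pd i (pd j w) y) :=
    fun i j => (hs1 j).mul (hs2 i j)
  have hpt : ∀ x, (Llam lam w x) ^ 2 - Gd lam w x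
      = (-2 * lam) * (∑ i, pd i (fun y => w y * pd i w y) x)
        + ∑ i, ∑ j, (pd j (fun y => pd i (pd i w) y * pd j w y) x
            - pd i (fun y => pd j w y * pd i (pd j w) y) x) := by
    intro x
    have e1 : ∀ i, pd i (fun y => w y * pd i w y) x
        = w x * pd i (pd i w) x + (pd i w x) ^ 2 := by
      intro i; rw [pd_mul i hw (hs1 i)]; ring
    have e2 : ∀ i j, pd j (fun y => pd i (pd i w) y * pd j w y) x
            - pd i (fun y => pd j w y * pd i (pd j w) y) x
          = pd i (pd i w) x * pd j (pd j w) x - (pd i (pd j w) x) ^ 2 := by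
      intro i j
      rw [pd_mul j (hs2 i i) (hs1 j), pd_mul i (hs1 j) (hs2 i j)]
      have : pd j (pd i (pd i w)) = pd i (pd i (pd j w)) := by
        rw [pd_comm j i (hs1 i), pd_comm j i hw]
      rw [this]; ring
    simp only [e1, e2, Finset.sum_sub_distrib, Finset.sum_add_distrib, ← Finset.mul_sum,
      ← Finset.sum_mul]
    unfold Llam Gd
    ring
  have hz : ∫ x in Set.Icc (0 : Fin n → ℝ) 1, ((Llam lam w x) ^ 2 - Gd lam w x) = 0 := by
    simp only [hpt]
    have i1 : ∀ i, IntegrableOn (fun x => pd i (fun y => w y * pd i w y) x)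
        (Set.Icc (0 : Fin n → ℝ) 1) := fun i => int_on (smth_pd i (a1 i)).continuous
    have i2 : ∀ i j, IntegrableOn (fun x => pd j (fun y => pd i (pd i w) y * pd j w y) x)
        (Set.Icc (0 : Fin n → ℝ) 1) := fun i j => int_on (smth_pd j (a2 i j)).continuous
    have i3 : ∀ i j, IntegrableOn (fun x => pd i (fun y => pd j w y * pd i (pd j w) y) x)
        (Set.Icc (0 : Fin n → ℝ) 1) := fun i j => int_on (smth_pd i (a3 i j)).continuous
    rw [integral_add, integral_const_mul, integral_finsetSum, integral_finsetSum]
    · have z1 : ∀ i, ∫ x in Set.Icc (0 : Fin n → ℝ) 1, pd i (fun y => w y * pd i w y) x = 0 :=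
        fun i => int_pd i (a1 i) (hmul hp (hp1 i))
      have z2 : ∀ i, ∫ x in Set.Icc (0 : Fin n → ℝ) 1,
          ∑ j, (pd j (fun y => pd i (pd i w) y * pd j w y) x
            - pd i (fun y => pd j w y * pd i (pd j w) y) x) = 0 := by
        intro i
        rw [integral_finsetSum]
        · apply Finset.sum_eq_zero
          intro j _
          rw [integral_sub (i2 i j) (i3 i j), int_pd j (a2 i j) (hmul (hp2 i i) (hp1 j)),
            int_pd i (a3 i j) (hmul (hp1 j) (hp2 i j)), sub_zero]
        · intro j _
          exact (i2 i j).sub (i3 i j)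
      simp only [z1, z2]
      simp
    · intro i _
      exact integrable_finsetSum _ fun j _ => (i2 i j).sub (i3 i j)
    · intro i _; exact i1 i
    · exact (integrable_finsetSum _ fun i _ => i1 i).const_mul _
    · exact integrable_finsetSum _ fun i _ =>
        integrable_finsetSum _ fun j _ => (i2 i j).sub (i3 i j)
  rw [integral_sub (int_sq lam hw) (int_on (cont_Gd lam hw))] at hz
  linarith

lemma cont_sup {X K : Type} [TopologicalSpace X] [TopologicalSpace K] [CompactSpace K]
    {g : X × K → ℝ} (hg : Continuous g) : Continuous fun x => ⨆ k : K, g (x, k) := by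
  have h := (isCompact_univ (X := K)).continuous_sSup (f := fun x k => g (x, k)) hg
  simpa [Set.image_univ, iSup] using h

lemma cont_inf {X K : Type} [TopologicalSpace X] [TopologicalSpace K] [CompactSpace K]
    {g : X × K → ℝ} (hg : Continuous g) : Continuous fun x => ⨅ k : K, g (x, k) := by
  have h := (isCompact_univ (X := K)).continuous_sInf (f := fun x k => g (x, k)) hg
  simpa [Set.image_univ, iInf] using h

lemma infsup_le {P Q : Type} [TopologicalSpace P] [CompactSpace P] [Nonempty P]
    [TopologicalSpace Q] [CompactSpace Q] [Nonempty Q] {g h : P × Q → ℝ}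
    (hg : Continuous g) (hh : Continuous h) (k : ℝ) (hle : ∀ q, g q ≤ h q + k) :
    (⨅ a, ⨆ b, g (a, b)) ≤ (⨅ a, ⨆ b, h (a, b)) + k := by
  rw [← sub_le_iff_le_add]
  refine le_ciInf fun a => ?_
  rw [sub_le_iff_le_add]
  refine (ciInf_le (isCompact_range (cont_sup hg)).bddBelow a).trans ?_
  refine ciSup_le fun b => (hle (a, b)).trans ?_
  have hb : BddAbove (Set.range fun b => h (a, b)) :=
    (isCompact_range (hh.comp (Continuous.prodMk_right a))).bddAbove
  have := le_ciSup hb b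
  linarith

lemma fip_eq {n : ℕ} (A M : Matrix (Fin n) (Fin n) ℝ) : fip A M = ∑ i, ∑ j, A i j * M i j := by
  unfold fip
  rw [Finset.sum_comm]
  simp [Matrix.trace, Matrix.mul_apply]

lemma D_pos {n : ℕ} {lam : ℝ} (hlam : 0 < lam) (A : Matrix (Fin n) (Fin n) ℝ)
    (b : Fin n → ℝ) {c : ℝ} (hc : 0 < c) :
    0 < fip A A + (∑ i, b i ^ 2) / (2 * lam) + c ^ 2 / lam ^ 2 := by
  have h1 : 0 ≤ fip A A := by
    rw [fip_eq]
    exact Finset.sum_nonneg fun i _ => Finset.sum_nonneg fun j _ => mul_self_nonneg _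
  have h2 : 0 ≤ (∑ i, b i ^ 2) / (2 * lam) :=
    div_nonneg (Finset.sum_nonneg fun i _ => sq_nonneg _) (by positivity)
  have h3 : 0 < c ^ 2 / lam ^ 2 := by positivity
  linarith

/-- Pointwise Cordes estimate. -/
lemma cordes_pt {n : ℕ} {lam δ : ℝ} (hlam : 0 < lam) (hδ : 0 < δ)
    (A : Matrix (Fin n) (Fin n) ℝ) (b : Fin n → ℝ) {c : ℝ} (hc : 0 < c)
    (hC : fip A A + (∑ i, b i ^ 2) / (2 * lam) + c ^ 2 / lam ^ 2
      ≤ (1 / ((n : ℝ) + δ)) * (A.trace + c / lam) ^ 2)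
    (M : Matrix (Fin n) (Fin n) ℝ) (p : Fin n → ℝ) (v : ℝ) :
    (gam lam A b c * (-(fip A M) - (∑ i, b i * p i) + c * v) - (lam * v - ∑ i, M i i)) ^ 2
      ≤ (1 - δ) * ((∑ i, ∑ j, (M i j) ^ 2) + 2 * lam * (∑ i, (p i) ^ 2) + lam ^ 2 * v ^ 2) := by
  have hD := D_pos hlam A b hc
  set D := fip A A + (∑ i, b i ^ 2) / (2 * lam) + c ^ 2 / lam ^ 2 with hDdef
  set T := A.trace + c / lam with hT
  set g := gam lam A b c with hgdef
  have hg : g = T / D := rfl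
  set r := Real.sqrt (2 * lam) with hr
  have hr2 : r ^ 2 = 2 * lam := Real.sq_sqrt (by positivity)
  have hr0 : 0 < r := Real.sqrt_pos.mpr (by positivity)
  have hl := hlam.ne'
  have cs := Finset.sum_mul_sq_le_sq_mul_sq Finset.univ
    (Sum.elim (fun ij : Fin n × Fin n => g * A ij.1 ij.2 - (1 : Matrix (Fin n) (Fin n) ℝ) ij.1 ij.2)
      (Sum.elim (fun i : Fin n => g * b i / r) (fun _ : Unit => 1 - g * c / lam)))
    (Sum.elim (fun ij : Fin n × Fin n => M ij.1 ij.2)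
      (Sum.elim (fun i : Fin n => r * p i) (fun _ : Unit => lam * v)))
  simp only [Fintype.sum_sum_type, Sum.elim_inl, Sum.elim_inr, Fintype.sum_prod_type,
    Finset.univ_unique, Finset.sum_singleton] at cs
  have hone : ∀ N : Matrix (Fin n) (Fin n) ℝ,
      ∑ i, ∑ j, (1 : Matrix (Fin n) (Fin n) ℝ) i j * N i j = ∑ i, N i i := by
    intro N; simp [Matrix.one_apply]
  have hone2 : ∑ i, ∑ j, ((1 : Matrix (Fin n) (Fin n) ℝ) i j) ^ 2 = n := by
    simp [Matrix.one_apply]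
  have s1 : ∑ i, ∑ j, (g * A i j - (1 : Matrix (Fin n) (Fin n) ℝ) i j) * M i j
      = g * fip A M - ∑ i, M i i := by
    rw [← hone M, fip_eq]
    simp only [Finset.mul_sum, ← Finset.sum_sub_distrib]
    refine Finset.sum_congr rfl fun i _ => Finset.sum_congr rfl fun j _ => by ring
  have s2 : ∑ i, g * b i / r * (r * p i) = g * ∑ i, b i * p i := by
    rw [Finset.mul_sum]
    refine Finset.sum_congr rfl fun i _ => by field_simp
  have s3 : ∑ i, ∑ j, (g * A i j - (1 : Matrix (Fin n) (Fin n) ℝ) i j) ^ 2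
      = g ^ 2 * fip A A - 2 * g * A.trace + n := by
    have ht : A.trace = ∑ i, A i i := rfl
    rw [← hone2, ht, ← hone A, fip_eq]
    simp only [Finset.mul_sum, ← Finset.sum_sub_distrib, ← Finset.sum_add_distrib]
    refine Finset.sum_congr rfl fun i _ => Finset.sum_congr rfl fun j _ => by ring
  have s4 : ∑ i, (g * b i / r) ^ 2 = g ^ 2 * ((∑ i, b i ^ 2) / (2 * lam)) := by
    rw [Finset.sum_div, Finset.mul_sum, ← hr2]
    refine Finset.sum_congr rfl fun i _ => by field_simp
  have s5 : ∑ i, (r * p i) ^ 2 = 2 * lam * ∑ i, (p i) ^ 2 := by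
    rw [← hr2, Finset.mul_sum]
    refine Finset.sum_congr rfl fun i _ => by ring
  rw [s1, s2, s3, s4, s5] at cs
  have hfac : g ^ 2 * fip A A - 2 * g * A.trace + n
      + (g ^ 2 * ((∑ i, b i ^ 2) / (2 * lam)) + (1 - g * c / lam) ^ 2) ≤ 1 - δ := by
    have e : g ^ 2 * fip A A - 2 * g * A.trace + n
      + (g ^ 2 * ((∑ i, b i ^ 2) / (2 * lam)) + (1 - g * c / lam) ^ 2)
        = g ^ 2 * D - 2 * g * T + n + 1 := by
      rw [hDdef, hT]; ring
    have e2 : g ^ 2 * D - 2 * g * T = - (T ^ 2 / D) := by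
      rw [hg]; field_simp; ring
    have hnd : (0 : ℝ) < n + δ := by positivity
    have e3 : (n : ℝ) + δ ≤ T ^ 2 / D := by
      rw [le_div_iff₀ hD]
      have := mul_le_mul_of_nonneg_left hC hnd.le
      rwa [← mul_assoc, mul_one_div_cancel hnd.ne', one_mul] at this
    rw [e, e2]; linarith
  have hG : 0 ≤ (∑ i, ∑ j, (M i j) ^ 2) + (2 * lam * (∑ i, (p i) ^ 2) + (lam * v) ^ 2) := by
    have h1 : 0 ≤ ∑ i, ∑ j, (M i j) ^ 2 :=
      Finset.sum_nonneg fun i _ => Finset.sum_nonneg fun j _ => sq_nonneg _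
    have h2 : 0 ≤ ∑ i, (p i) ^ 2 := Finset.sum_nonneg fun i _ => sq_nonneg _
    positivity
  have := cs.trans (mul_le_mul_of_nonneg_right hfac hG)
  have el : (1 - g * c / lam) * (lam * v) = lam * v - g * c * v := by field_simp
  rw [el] at this
  calc _ = (g * fip A M - ∑ i, M i i + (g * ∑ i, b i * p i + (lam * v - g * c * v))) ^ 2 := by ring
    _ ≤ _ := this
    _ = _ := by ring

/-- strong monotonicity estimate for the renormalized HJBI operator. -/
theorem stmt9 {n : ℕ} (hn : 1 ≤ n) (lam δ : ℝ) (hlam : 0 < lam)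
    (hδ : δ ∈ Set.Ioo (0 : ℝ) 1)
    (𝒜 ℬ : Type) [MetricSpace 𝒜] [CompactSpace 𝒜] [Nonempty 𝒜]
    [MetricSpace ℬ] [CompactSpace ℬ] [Nonempty ℬ]
    (A : (Fin n → ℝ) × 𝒜 × ℬ → Matrix (Fin n) (Fin n) ℝ)
    (b : (Fin n → ℝ) × 𝒜 × ℬ → Fin n → ℝ)
    (c f : (Fin n → ℝ) × 𝒜 × ℬ → ℝ)
    (hAc : Continuous A) (hbc : Continuous b) (hcc : Continuous c) (hfc : Continuous f)
    (hAsymm : ∀ q, (A q).IsSymm)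
    (hAper : ∀ (y : Fin n → ℝ) (z : Fin n → ℤ) (α : 𝒜) (β : ℬ),
      A ((y + fun i => (z i : ℝ)), α, β) = A (y, α, β))
    (hbper : ∀ (y : Fin n → ℝ) (z : Fin n → ℤ) (α : 𝒜) (β : ℬ),
      b ((y + fun i => (z i : ℝ)), α, β) = b (y, α, β))
    (hcper : ∀ (y : Fin n → ℝ) (z : Fin n → ℤ) (α : 𝒜) (β : ℬ),
      c ((y + fun i => (z i : ℝ)), α, β) = c (y, α, β))
    (hfper : ∀ (y : Fin n → ℝ) (z : Fin n → ℤ) (α : 𝒜) (β : ℬ),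
      f ((y + fun i => (z i : ℝ)), α, β) = f (y, α, β))
    (hcpos : ∀ q, 0 < c q)
    (hCordes : ∀ q, fip (A q) (A q) + (∑ i, b q i ^ 2) / (2 * lam) + c q ^ 2 / lam ^ 2
      ≤ (1 / ((n : ℝ) + δ)) * ((A q).trace + c q / lam) ^ 2)
    (u₁ u₂ : (Fin n → ℝ) → ℝ)
    (hu₁ : ContDiff ℝ (⊤ : ℕ∞) u₁) (hu₂ : ContDiff ℝ (⊤ : ℕ∞) u₂)
    (hp₁ : ZPeriodic u₁) (hp₂ : ZPeriodic u₂) :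
    (1 - Real.sqrt (1 - δ))
        * ∫ x in Set.Icc (0 : Fin n → ℝ) 1, (Llam lam (u₁ - u₂) x) ^ 2
      ≤ ∫ x in Set.Icc (0 : Fin n → ℝ) 1,
          (Fgam lam A b c f u₁ x - Fgam lam A b c f u₂ x) * Llam lam (u₁ - u₂) x := by
  have hw : Smth (u₁ - u₂) := hu₁.sub hu₂
  have hwp : ZPeriodic (u₁ - u₂) := by
    intro x z
    simp only [Pi.sub_apply, hp₁ x z, hp₂ x z]
  -- the integrand of the operator as a jointly continuous function
  let H : ((Fin n → ℝ) → ℝ) → (Fin n → ℝ) × 𝒜 × ℬ → ℝ := fun v q =>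
    gam lam (A q) (b q) (c q) *
      (-(fip (A q) (hess v q.1)) - (∑ i, b q i * pd i v q.1) + c q * v q.1 - f q)
  have hAij : ∀ i j, Continuous fun q => A q i j := fun i j => hAc.matrix_elem i j
  have hbi : ∀ i, Continuous fun q => b q i := fun i => (continuous_apply i).comp hbc
  have hgam : Continuous fun q => gam lam (A q) (b q) (c q) := by
    unfold gam
    refine Continuous.div ?_ ?_ (fun q => (D_pos hlam (A q) (b q) (hcpos q)).ne')
    · exact (hAc.matrix_trace).add (hcc.div_const _)
    · simp only [fip_eq]
      fun_prop
  have hH : ∀ v, Smth v → Continuous (H v) := by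
    intro v hv
    have h0 := hv.continuous
    have h1 : ∀ i, Continuous (pd i v) := fun i => (smth_pd i hv).continuous
    have h2 : ∀ i j, Continuous (pd i (pd j v)) :=
      fun i j => (smth_pd i (smth_pd j hv)).continuous
    refine hgam.mul ?_
    simp only [fip_eq, hess, Matrix.of_apply]
    fun_prop
  have hF : ∀ v y, Fgam lam A b c f v y = ⨅ α, ⨆ β, H v (y, α, β) := fun v y => rfl
  have hFc : ∀ v, Smth v → Continuous (Fgam lam A b c f v) := by
    intro v hv
    have e : Continuous fun p : ((Fin n → ℝ) × 𝒜) × ℬ => H v (p.1.1, p.1.2, p.2) :=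
      (hH v hv).comp (by fun_prop)
    exact cont_inf (cont_sup e)
  set s := Real.sqrt (1 - δ) with hs
  have hs0 : 0 ≤ s := Real.sqrt_nonneg _
  have hs2 : s ^ 2 = 1 - δ := Real.sq_sqrt (by linarith [hδ.2])
  have hGn : ∀ x, 0 ≤ Gd lam (u₁ - u₂) x := by
    intro x
    unfold Gd
    have h1 : 0 ≤ ∑ i, ∑ j, (pd i (pd j (u₁ - u₂)) x) ^ 2 :=
      Finset.sum_nonneg fun i _ => Finset.sum_nonneg fun j _ => sq_nonneg _
    have h2 : 0 ≤ ∑ i, (pd i (u₁ - u₂) x) ^ 2 := Finset.sum_nonneg fun i _ => sq_nonneg _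
    positivity
  have hbd : ∀ x q, |H u₁ (x, q) - H u₂ (x, q) - Llam lam (u₁ - u₂) x|
      ≤ s * Real.sqrt (Gd lam (u₁ - u₂) x) := by
    intro x q
    have hc := cordes_pt hlam hδ.1 (A (x, q)) (b (x, q)) (hcpos (x, q)) (hCordes (x, q))
      (hess (u₁ - u₂) x) (fun i => pd i (u₁ - u₂) x) ((u₁ - u₂) x)
    have hh : hess (u₁ - u₂) x = hess u₁ x - hess u₂ x := by
      ext i j
      simp only [hess, Matrix.of_apply, Matrix.sub_apply]
      rw [pd_sub j hu₁ hu₂, pd_sub i (smth_pd j hu₁) (smth_pd j hu₂)]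
      rfl
    have hfs : fip (A (x, q)) (hess (u₁ - u₂) x)
        = fip (A (x, q)) (hess u₁ x) - fip (A (x, q)) (hess u₂ x) := by
      rw [hh]; simp [fip, Matrix.mul_sub]
    have hps : ∑ i, b (x, q) i * pd i (u₁ - u₂) x
        = ∑ i, b (x, q) i * pd i u₁ x - ∑ i, b (x, q) i * pd i u₂ x := by
      rw [← Finset.sum_sub_distrib]
      refine Finset.sum_congr rfl fun i _ => ?_
      rw [pd_sub i hu₁ hu₂, Pi.sub_apply]; ring
    rw [← Real.sqrt_mul (by linarith [hδ.2])]
    apply Real.abs_le_sqrt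
    refine le_trans (le_of_eq ?_) hc
    rw [hfs, hps]
    simp only [H, Llam, hess, Matrix.of_apply, Pi.sub_apply]
    ring
  have hFb : ∀ x, |Fgam lam A b c f u₁ x - Fgam lam A b c f u₂ x - Llam lam (u₁ - u₂) x|
      ≤ s * Real.sqrt (Gd lam (u₁ - u₂) x) := by
    intro x
    have c1 : Continuous fun q : 𝒜 × ℬ => H u₁ (x, q) := (hH _ hu₁).comp (by fun_prop)
    have c2 : Continuous fun q : 𝒜 × ℬ => H u₂ (x, q) := (hH _ hu₂).comp (by fun_prop)
    have l1 := infsup_le c1 c2 (Llam lam (u₁ - u₂) x + s * Real.sqrt (Gd lam (u₁ - u₂) x))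
      (fun q => by have := (abs_le.mp (hbd x q)).2; linarith)
    have l2 := infsup_le c2 c1 (-Llam lam (u₁ - u₂) x + s * Real.sqrt (Gd lam (u₁ - u₂) x))
      (fun q => by have := (abs_le.mp (hbd x q)).1; linarith)
    rw [hF, hF, abs_le]
    constructor <;> linarith
  have hpt : ∀ x, (Llam lam (u₁ - u₂) x) ^ 2
        - s / 2 * (Gd lam (u₁ - u₂) x + (Llam lam (u₁ - u₂) x) ^ 2)
      ≤ (Fgam lam A b c f u₁ x - Fgam lam A b c f u₂ x) * Llam lam (u₁ - u₂) x := by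
    intro x
    set L := Llam lam (u₁ - u₂) x
    set E := Fgam lam A b c f u₁ x - Fgam lam A b c f u₂ x
    set t := Real.sqrt (Gd lam (u₁ - u₂) x) with ht
    have ht2 : t ^ 2 = Gd lam (u₁ - u₂) x := Real.sq_sqrt (hGn x)
    rw [← ht2]
    have h1 : |(E - L) * L| ≤ s * t * |L| := by
      rw [abs_mul]
      exact mul_le_mul_of_nonneg_right (hFb x) (abs_nonneg _)
    have h2 := (abs_le.mp h1).1
    have h3 : t * |L| ≤ (t ^ 2 + L ^ 2) / 2 := by
      have := sq_nonneg (t - |L|)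
      rw [← sq_abs L]; nlinarith
    have h4 := mul_le_mul_of_nonneg_left h3 hs0
    nlinarith
  have hL2 := int_sq lam hw
  have hGi := int_on (cont_Gd lam hw)
  have hmono := setIntegral_mono (μ := volume) (s := Set.Icc (0 : Fin n → ℝ) 1)
    (hL2.sub ((hGi.add hL2).const_mul (s / 2)))
    (int_on (((hFc u₁ hu₁).sub (hFc u₂ hu₂)).mul (cont_Llam lam hw))) hpt
  have hcomp : ∫ x in Set.Icc (0 : Fin n → ℝ) 1, ((Llam lam (u₁ - u₂) x) ^ 2
        - s / 2 * (Gd lam (u₁ - u₂) x + (Llam lam (u₁ - u₂) x) ^ 2))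
      = (1 - s) * ∫ x in Set.Icc (0 : Fin n → ℝ) 1, (Llam lam (u₁ - u₂) x) ^ 2 := by
    have h1 : IntegrableOn (fun x => s / 2 * (Gd lam (u₁ - u₂) x + (Llam lam (u₁ - u₂) x) ^ 2))
        (Set.Icc (0 : Fin n → ℝ) 1) := (hGi.add hL2).const_mul (s / 2)
    rw [integral_sub hL2 h1, integral_const_mul, integral_add hGi hL2, energy lam hw hwp]
    ring
  rw [← hcomp]
  exact hmono
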